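/- As h → 0⁻ one has the asymptotic expansions Ī₀(h) = 2√2/3 + h(−log(−h) + 1 + 6 log 2)/(4√2) + o(h) and Ī₂(h) = 8√2/15 + h/√2 + o(h). -/

import Mathlib

open intervalIntegral Real Filter Asymptotics

/-- `Ī_k(h) = ∫_{u₁(h)}^{u₂(h)} u^k √(h + 2u² − u⁴) du` where
`u₁(h) = √(1 − √(1+h))` and `u₂(h) = √(1 + √(1+h))`. -/
noncomputable def Ibar (k : ℕ) (h : ℝ) : ℝ :=
  ∫ u in (Real.sqrt (1 - Real.sqrt (1 + h)))..(Real.sqrt (1 + Real.sqrt (1 + h))),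
    u ^ k * Real.sqrt (h + 2 * u ^ 2 - u ^ 4)

open MeasureTheory Set Topology

/-- The difference quotient of the square root at `x` with increment `h`. -/
noncomputable def sqrtQuot (h x : ℝ) : ℝ := h⁻¹ * (√(x + h) - √x)

lemma continuous_sqrtQuot (h : ℝ) : Continuous (sqrtQuot h) := by
  unfold sqrtQuot; fun_prop

lemma tendsto_sqrtQuot {x : ℝ} (hx : 0 < x) :
    Tendsto (fun h => sqrtQuot h x) (𝓝[<] 0) (𝓝 (1 / (2 * √x))) := by
  simpa only [smul_eq_mul, sqrtQuot] using (Real.hasDerivAt_sqrt hx.ne').tendsto_slope_zero_left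

lemma sqrtQuot_nonneg {h : ℝ} (hh : h < 0) (x : ℝ) : 0 ≤ sqrtQuot h x := by
  unfold sqrtQuot
  refine mul_nonneg_of_nonpos_of_nonpos (inv_nonpos.2 hh.le) ?_
  linarith [Real.sqrt_le_sqrt (show x + h ≤ x by linarith)]

lemma sqrtQuot_le {h x : ℝ} (hh : h < 0) (hx : 0 < x) : sqrtQuot h x ≤ 1 / √x := by
  have hs : 0 < √x := Real.sqrt_pos.2 hx
  have hq : x + h ≤ √(x + h) * √x := by
    rcases le_total (x + h) 0 with h0 | h0
    · exact h0.trans (by positivity)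
    · nlinarith [Real.sq_sqrt h0, Real.sqrt_le_sqrt (show x + h ≤ x by linarith),
        Real.sqrt_nonneg (x + h)]
  have hkey : (√x - √(x + h)) * √x ≤ -h := by nlinarith [Real.sq_sqrt hx.le]
  have he : sqrtQuot h x = (√x - √(x + h)) / (-h) := by
    unfold sqrtQuot
    rw [inv_mul_eq_div, ← neg_div_neg_eq, neg_sub]
  rw [he, div_le_div_iff₀ (by linarith) hs]
  linarith

lemma sqrt_sub_sqrt_le {a b d : ℝ} (hd : 0 ≤ d) (h : b - a ≤ d ^ 2) :
    √b - √a ≤ d := by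
  rw [sub_le_iff_le_add]
  refine Real.sqrt_le_iff.2 ⟨by positivity, ?_⟩
  rcases le_total a 0 with ha | ha
  · nlinarith [Real.sqrt_eq_zero_of_nonpos ha]
  · nlinarith [Real.sq_sqrt ha, Real.sqrt_nonneg a]

/-- Difference quotients of the square root at two points whose distance is quadratically small
stay at bounded distance. -/
lemma abs_sqrtQuot_sub_le {h w v : ℝ} (hh : h < 0) (hw : 0 < w) (hwv : w ≤ v)
    (hd : v - w ≤ w ^ 2) : |sqrtQuot h w - sqrtQuot h v| ≤ 2 := by
  have h1 : √v - √w ≤ w := sqrt_sub_sqrt_le hw.le hd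
  have h2 : √(v + h) - √(w + h) ≤ w :=
    sqrt_sub_sqrt_le hw.le (by linarith)
  have h3 : √w ≤ √v := Real.sqrt_le_sqrt hwv
  have h4 : √(w + h) ≤ √(v + h) := Real.sqrt_le_sqrt (by linarith)
  have he : sqrtQuot h w - sqrtQuot h v
      = (√w - √(w + h) - (√v - √(v + h))) / (-h) := by
    unfold sqrtQuot
    field_simp
    ring
  rw [he, abs_div, abs_of_pos (show 0 < -h by linarith), div_le_iff₀ (by linarith)]
  rcases le_total (w + h) 0 with h0 | h0
  · rw [abs_le]
    constructor <;> linarith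
  · have ha : 0 < √w := Real.sqrt_pos.2 hw
    have hb : 0 < √v := Real.sqrt_pos.2 (hw.trans_le hwv)
    have ea : √w - √(w + h) = -h / (√w + √(w + h)) := by
      rw [eq_div_iff (by positivity)]
      nlinarith [Real.sq_sqrt hw.le, Real.sq_sqrt h0]
    have eb : √v - √(v + h) = -h / (√v + √(v + h)) := by
      rw [eq_div_iff (by positivity)]
      nlinarith [Real.sq_sqrt (hw.le.trans hwv),
        Real.sq_sqrt (show 0 ≤ v + h by linarith)]
    have hle : -h / (√v + √(v + h)) ≤ -h / (√w + √(w + h)) :=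
      div_le_div_of_nonneg_left (by linarith) (by positivity) (by linarith)
    have hd : -h / (√w + √(w + h)) - -h / (√v + √(v + h)) ≤ 2 * -h := by
      rw [div_sub_div _ _ (by positivity) (by positivity), div_le_iff₀ (by positivity)]
      have hprod : w ≤ (√w + √(w + h)) * (√v + √(v + h)) := by
        have := mul_le_mul (show √w ≤ √w + √(w + h) by linarith [Real.sqrt_nonneg (w + h)])
          (show √w ≤ √v + √(v + h) by linarith [Real.sqrt_nonneg (v + h)]) ha.le (by positivity)
        rwa [Real.mul_self_sqrt hw.le] at this
      nlinarith
    rw [ea, eb, abs_le]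
    constructor <;> linarith

/-- Dominated convergence on `(0, √2)` for families of continuous functions indexed by `h < 0`. -/
lemma tendsto_integral_of_dominated {F : ℝ → ℝ → ℝ} {f B : ℝ → ℝ}
    (hF : ∀ h, Continuous (F h))
    (hB : IntervalIntegrable B volume 0 (√2))
    (hbound : ∀ h < 0, ∀ u ∈ Ioo 0 (√2), |F h u| ≤ B u)
    (hlim : ∀ u ∈ Ioo 0 (√2), Tendsto (fun h => F h u) (𝓝[<] 0) (𝓝 (f u))) :
    Tendsto (fun h => ∫ u in (0 : ℝ)..√2, F h u) (𝓝[<] 0) (𝓝 (∫ u in (0 : ℝ)..√2, f u)) := by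
  have hne : ∀ᵐ u : ℝ, u ≠ √2 := by simp [ae_iff, measure_singleton]
  have hmem : ∀ u : ℝ, u ≠ √2 → u ∈ uIoc 0 (√2) → u ∈ Ioo 0 (√2) := by
    intro u hu hu'
    rw [uIoc_of_le (Real.sqrt_nonneg 2)] at hu'
    exact ⟨hu'.1, lt_of_le_of_ne hu'.2 hu⟩
  refine intervalIntegral.tendsto_integral_filter_of_dominated_convergence B ?_ ?_ hB ?_
  · exact Eventually.of_forall fun h => (hF h).aestronglyMeasurable
  · filter_upwards [self_mem_nhdsWithin] with h hh
    filter_upwards [hne] with u hu hu'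
    exact hbound h hh u (hmem u hu hu')
  · filter_upwards [hne] with u hu hu'
    exact hlim u (hmem u hu hu')

lemma two_sub_sq_pos {u : ℝ} (hu : u ∈ Ioo 0 (√2)) : 0 < 2 - u ^ 2 := by
  nlinarith [hu.1, hu.2, Real.sq_sqrt (show (0 : ℝ) ≤ 2 by norm_num)]

lemma sqrt_two_mul_sq_sub {u : ℝ} (hu : u ∈ Ioo 0 (√2)) :
    √(2 * u ^ 2 - u ^ 4) = u * √(2 - u ^ 2) := by
  rw [show 2 * u ^ 2 - u ^ 4 = u ^ 2 * (2 - u ^ 2) by ring, Real.sqrt_mul (sq_nonneg u),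
    Real.sqrt_sq hu.1.le]

lemma sqrt_two_mul_sq {u : ℝ} (hu : 0 ≤ u) : √(2 * u ^ 2) = √2 * u := by
  rw [Real.sqrt_mul (by norm_num), Real.sqrt_sq hu]

lemma hasDerivAt_sqrt_two_sub {u : ℝ} (hu : u ∈ Ioo 0 (√2)) :
    HasDerivAt (fun u : ℝ => √(2 - u ^ 2)) (-u / √(2 - u ^ 2)) u := by
  have h := ((hasDerivAt_const u (2 : ℝ)).sub (hasDerivAt_pow 2 u)).sqrt (two_sub_sq_pos hu).ne'
  refine h.congr_deriv ?_
  have := Real.sqrt_pos.2 (two_sub_sq_pos hu)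
  simp only [Pi.sub_apply]
  field_simp
  simp

lemma intervalIntegrable_div_sqrt :
    IntervalIntegrable (fun u => u / √(2 - u ^ 2)) volume 0 (√2) := by
  refine intervalIntegral.intervalIntegrable_deriv_of_nonneg
    (g := fun u => -√(2 - u ^ 2)) (by fun_prop) ?_ ?_
  · intro u hu
    rw [min_eq_left (Real.sqrt_nonneg 2), max_eq_right (Real.sqrt_nonneg 2)] at hu
    exact (hasDerivAt_sqrt_two_sub hu).neg.congr_deriv (by ring)
  · intro u hu
    rw [min_eq_left (Real.sqrt_nonneg 2), max_eq_right (Real.sqrt_nonneg 2)] at hu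
    exact div_nonneg hu.1.le (Real.sqrt_nonneg _)

lemma integral_div_sqrt : ∫ u in (0 : ℝ)..√2, u / √(2 - u ^ 2) = √2 := by
  rw [intervalIntegral.integral_eq_sub_of_hasDerivAt_of_le (f := fun u => -√(2 - u ^ 2))
    (Real.sqrt_nonneg 2) (by fun_prop)
    (fun u hu => (hasDerivAt_sqrt_two_sub hu).neg.congr_deriv (by ring))
    intervalIntegrable_div_sqrt]
  simp

lemma integral_sqrt_zero_level : ∫ u in (0 : ℝ)..√2, √(2 * u ^ 2 - u ^ 4) = 2 * √2 / 3 := by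
  rw [intervalIntegral.integral_eq_sub_of_hasDerivAt_of_le
    (f := fun u => -(√(2 - u ^ 2)) ^ 3 / 3) (Real.sqrt_nonneg 2) (by fun_prop) ?_
    (Continuous.intervalIntegrable (by fun_prop) _ _)]
  · simp [pow_succ]
    ring
  · intro u hu
    refine (((hasDerivAt_sqrt_two_sub hu).pow 3).neg.div_const 3).congr_deriv ?_
    rw [sqrt_two_mul_sq_sub hu]
    have := Real.sqrt_pos.2 (two_sub_sq_pos hu)
    field_simp
    ring

lemma integral_sq_mul_sqrt_zero_level :
    ∫ u in (0 : ℝ)..√2, u ^ 2 * √(2 * u ^ 2 - u ^ 4) = 8 * √2 / 15 := by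
  rw [intervalIntegral.integral_eq_sub_of_hasDerivAt_of_le
    (f := fun u => (√(2 - u ^ 2)) ^ 5 / 5 - 2 * (√(2 - u ^ 2)) ^ 3 / 3)
    (Real.sqrt_nonneg 2) (by fun_prop) ?_
    (Continuous.intervalIntegrable (by fun_prop) _ _)]
  · have hr2 : √2 ^ 2 = 2 := Real.sq_sqrt (by norm_num)
    have hr3 : √2 ^ 3 = 2 * √2 := by linear_combination √2 * hr2
    have hr5 : √2 ^ 5 = 4 * √2 := by linear_combination (√2 ^ 3 + 2 * √2) * hr2
    simp [hr3, hr5]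
    ring
  · intro u hu
    refine ((((hasDerivAt_sqrt_two_sub hu).pow 5).div_const 5).sub
      ((((hasDerivAt_sqrt_two_sub hu).pow 3).const_mul 2).div_const 3)).congr_deriv ?_
    rw [sqrt_two_mul_sq_sub hu]
    have hs := Real.sqrt_pos.2 (two_sub_sq_pos hu)
    have hq := Real.sq_sqrt (two_sub_sq_pos hu).le
    generalize √(2 - u ^ 2) = S at *
    have hu2 : u ^ 2 = 2 - S ^ 2 := by linarith
    rw [hu2]
    field_simp
    ring

/-- Extending the integrand by the junk value of `√` at negative numbers, the integral
may be taken over the fixed interval `[0, √2]`. -/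
lemma Ibar_eq (k : ℕ) {h : ℝ} (h1 : -1 < h) (h0 : h < 0) :
    Ibar k h = ∫ u in (0 : ℝ)..√2, u ^ k * √(2 * u ^ 2 - u ^ 4 + h) := by
  have hs0 : 0 ≤ √(1 + h) := Real.sqrt_nonneg _
  have hsq : √(1 + h) ^ 2 = 1 + h := Real.sq_sqrt (by linarith)
  have hs1 : √(1 + h) ≤ 1 := by nlinarith
  have hint : ∀ a b : ℝ, IntervalIntegrable
      (fun u : ℝ => u ^ k * √(2 * u ^ 2 - u ^ 4 + h)) volume a b :=
    fun a b => Continuous.intervalIntegrable (by fun_prop) _ _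
  have hfac : ∀ u : ℝ, 2 * u ^ 2 - u ^ 4 + h
      = (u ^ 2 - (1 - √(1 + h))) * ((1 + √(1 + h)) - u ^ 2) := by
    intro u; linear_combination -hsq
  have hI : Ibar k h = ∫ u in (√(1 - √(1 + h)))..(√(1 + √(1 + h))),
      u ^ k * √(2 * u ^ 2 - u ^ 4 + h) := by
    unfold Ibar
    congr 1
    ext u
    rw [show h + 2 * u ^ 2 - u ^ 4 = 2 * u ^ 2 - u ^ 4 + h by ring]
  have hl : ∫ u in (0 : ℝ)..(√(1 - √(1 + h))), u ^ k * √(2 * u ^ 2 - u ^ 4 + h) = 0 := by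
    rw [intervalIntegral.integral_congr_uIoo (g := fun _ => (0 : ℝ))]
    · simp
    · intro u hu
      rw [uIoo_of_le (Real.sqrt_nonneg _)] at hu
      have : u ^ 2 < 1 - √(1 + h) := (Real.lt_sqrt hu.1.le).1 hu.2
      have hz : √(2 * u ^ 2 - u ^ 4 + h) = 0 := by
        rw [hfac]
        exact Real.sqrt_eq_zero_of_nonpos
          (mul_nonpos_of_nonpos_of_nonneg (by linarith) (by linarith))
      simp [hz]
  have hr : ∫ u in (√(1 + √(1 + h)))..(√2), u ^ k * √(2 * u ^ 2 - u ^ 4 + h) = 0 := by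
    rw [intervalIntegral.integral_congr_uIoo (g := fun _ => (0 : ℝ))]
    · simp
    · intro u hu
      rw [uIoo_of_le (Real.sqrt_le_sqrt (by linarith))] at hu
      have : 1 + √(1 + h) < u ^ 2 :=
        (Real.sqrt_lt' (lt_of_le_of_lt (Real.sqrt_nonneg _) hu.1)).1 hu.1
      have hz : √(2 * u ^ 2 - u ^ 4 + h) = 0 := by
        rw [hfac]
        exact Real.sqrt_eq_zero_of_nonpos
          (mul_nonpos_of_nonneg_of_nonpos (by linarith) (by linarith))
      simp [hz]
  rw [hI, ← intervalIntegral.integral_add_adjacent_intervals (hint 0 (√(1 - √(1 + h)))) (hint _ _),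
    ← intervalIntegral.integral_add_adjacent_intervals (hint _ (√(1 + √(1 + h)))) (hint _ (√2)),
    hl, hr, zero_add, add_zero]

lemma eventually_neg_one_lt : ∀ᶠ h : ℝ in 𝓝[<] 0, -1 < h ∧ h < 0 :=
  Ioo_mem_nhdsLT (by norm_num)

lemma integral_sqrtQuot_Ibar (k : ℕ) {h : ℝ} (h1 : -1 < h) (h0 : h < 0) :
    ∫ u in (0 : ℝ)..√2, u ^ k * sqrtQuot h (2 * u ^ 2 - u ^ 4)
      = h⁻¹ * (Ibar k h - ∫ u in (0 : ℝ)..√2, u ^ k * √(2 * u ^ 2 - u ^ 4)) := by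
  rw [Ibar_eq k h1 h0, ← intervalIntegral.integral_sub
    (Continuous.intervalIntegrable (by fun_prop) _ _)
    (Continuous.intervalIntegrable (by fun_prop) _ _), ← intervalIntegral.integral_const_mul]
  congr 1
  ext u
  unfold sqrtQuot
  ring

lemma level_pos {u : ℝ} (hu : u ∈ Ioo 0 (√2)) : 0 < 2 * u ^ 2 - u ^ 4 := by
  have := mul_pos (pow_pos hu.1 2) (two_sub_sq_pos hu)
  linarith

lemma tendsto_Ibar_two :
    Tendsto (fun h => h⁻¹ * (Ibar 2 h - 8 * √2 / 15)) (𝓝[<] 0) (𝓝 (√2 / 2)) := by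
  have key : Tendsto
      (fun h => ∫ u in (0 : ℝ)..√2, u ^ 2 * sqrtQuot h (2 * u ^ 2 - u ^ 4)) (𝓝[<] 0)
      (𝓝 (∫ u in (0 : ℝ)..√2, (u / √(2 - u ^ 2)) / 2)) := by
    refine tendsto_integral_of_dominated (B := fun u => u / √(2 - u ^ 2)) ?_
      intervalIntegrable_div_sqrt ?_ ?_
    · intro h
      exact (continuous_pow 2).mul ((continuous_sqrtQuot h).comp (by fun_prop))
    · intro h hh u hu
      have hs := Real.sqrt_pos.2 (two_sub_sq_pos hu)
      have hq := sqrtQuot_le hh (level_pos hu)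
      rw [abs_of_nonneg (mul_nonneg (sq_nonneg u) (sqrtQuot_nonneg hh _))]
      refine (mul_le_mul_of_nonneg_left hq (sq_nonneg u)).trans (le_of_eq ?_)
      rw [sqrt_two_mul_sq_sub hu]
      have := hu.1
      field_simp
    · intro u hu
      have hs := Real.sqrt_pos.2 (two_sub_sq_pos hu)
      have := hu.1
      convert (tendsto_sqrtQuot (level_pos hu)).const_mul (u ^ 2) using 2
      rw [sqrt_two_mul_sq_sub hu]
      field_simp
  rw [intervalIntegral.integral_div, integral_div_sqrt] at key
  refine key.congr' ?_
  filter_upwards [eventually_neg_one_lt] with h hh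
  rw [integral_sqrtQuot_Ibar 2 hh.1 hh.2, integral_sq_mul_sqrt_zero_level]

lemma hasDerivAt_neg_log_add_sqrt {u : ℝ} (hu : u ∈ Ioo 0 (√2)) :
    HasDerivAt (fun u : ℝ => -(1 / (2 * √2)) * Real.log (√2 + √(2 - u ^ 2)))
      (1 / (2 * √(2 * u ^ 2 - u ^ 4)) - 1 / (2 * √(2 * u ^ 2))) u := by
  have hs := Real.sqrt_pos.2 (two_sub_sq_pos hu)
  have hq := Real.sq_sqrt (two_sub_sq_pos hu).le
  have hr : 0 < √2 := Real.sqrt_pos.2 (by norm_num)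
  have hr2 : √2 ^ 2 = 2 := Real.sq_sqrt (by norm_num)
  have hu0 := hu.1
  refine ((((hasDerivAt_sqrt_two_sub hu).const_add (√2)).log (by positivity)).const_mul
    (-(1 / (2 * √2)))).congr_deriv ?_
  rw [sqrt_two_mul_sq_sub hu, sqrt_two_mul_sq hu0.le]
  generalize √(2 - u ^ 2) = S at *
  generalize √2 = r at *
  field_simp
  linear_combination hq - hr2

lemma neg_log_add_sqrt_deriv_nonneg {u : ℝ} (hu : u ∈ Ioo 0 (√2)) :
    0 ≤ 1 / (2 * √(2 * u ^ 2 - u ^ 4)) - 1 / (2 * √(2 * u ^ 2)) := by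
  have h1 : √(2 * u ^ 2 - u ^ 4) ≤ √(2 * u ^ 2) :=
    Real.sqrt_le_sqrt (by nlinarith [sq_nonneg (u ^ 2)])
  have h2 := Real.sqrt_pos.2 (level_pos hu)
  exact sub_nonneg.2 (one_div_le_one_div_of_le (by positivity) (by linarith))

lemma integral_regularized :
    ∫ u in (0 : ℝ)..√2, (1 / (2 * √(2 * u ^ 2 - u ^ 4)) - 1 / (2 * √(2 * u ^ 2)))
      = Real.log 2 / (2 * √2) := by
  have hr : 0 < √2 := Real.sqrt_pos.2 (by norm_num)
  have hc : ContinuousOn (fun u : ℝ => -(1 / (2 * √2)) * Real.log (√2 + √(2 - u ^ 2)))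
      (Icc 0 (√2)) := by
    refine ContinuousOn.mul continuousOn_const (ContinuousOn.log (by fun_prop) ?_)
    intro u _
    positivity
  have hint : IntervalIntegrable
      (fun u : ℝ => 1 / (2 * √(2 * u ^ 2 - u ^ 4)) - 1 / (2 * √(2 * u ^ 2))) volume 0 (√2) := by
    rw [intervalIntegrable_iff_integrableOn_Ioc_of_le hr.le]
    exact intervalIntegral.integrableOn_deriv_of_nonneg hc
      (fun u hu => hasDerivAt_neg_log_add_sqrt hu) (fun u hu => neg_log_add_sqrt_deriv_nonneg hu)
  rw [intervalIntegral.integral_eq_sub_of_hasDerivAt_of_le hr.le hc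
    (fun u hu => hasDerivAt_neg_log_add_sqrt hu) hint]
  simp only [Real.sq_sqrt (show (0 : ℝ) ≤ 2 by norm_num), sub_self, Real.sqrt_zero, add_zero]
  rw [show √2 + √(2 - 0 ^ 2) = 2 * √2 by norm_num; ring, Real.log_mul (by norm_num) hr.ne']
  ring

lemma tendsto_integral_regularized :
    Tendsto (fun h => ∫ u in (0 : ℝ)..√2,
        (sqrtQuot h (2 * u ^ 2 - u ^ 4) - sqrtQuot h (2 * u ^ 2)))
      (𝓝[<] 0) (𝓝 (Real.log 2 / (2 * √2))) := by
  rw [← integral_regularized]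
  refine tendsto_integral_of_dominated (B := fun u => 2 + u / √(2 - u ^ 2)) ?_
    (intervalIntegrable_const.add intervalIntegrable_div_sqrt) ?_ ?_
  · intro h
    exact ((continuous_sqrtQuot h).comp (by fun_prop)).sub
      ((continuous_sqrtQuot h).comp (by fun_prop))
  · intro h hh u hu
    have hs := Real.sqrt_pos.2 (two_sub_sq_pos hu)
    have hu0 := hu.1
    have hw := level_pos hu
    have hwv : 2 * u ^ 2 - u ^ 4 ≤ 2 * u ^ 2 := by nlinarith [sq_nonneg (u ^ 2)]
    have hpos : 0 ≤ u / √(2 - u ^ 2) := by positivity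
    rcases le_total u 1 with h1 | h1
    · have hd : 2 * u ^ 2 - (2 * u ^ 2 - u ^ 4) ≤ (2 * u ^ 2 - u ^ 4) ^ 2 := by
        have : u ^ 2 ≤ 2 * u ^ 2 - u ^ 4 := by
          nlinarith [mul_nonneg (sq_nonneg u) (show 0 ≤ 1 - u ^ 2 by nlinarith)]
        nlinarith [sq_nonneg u]
      linarith [abs_sqrtQuot_sub_le hh hw hwv hd]
    · have hq := sqrtQuot_le hh hw
      have hq' := (sqrtQuot_le hh (hw.trans_le hwv)).trans
        (one_div_le_one_div_of_le (Real.sqrt_pos.2 hw) (Real.sqrt_le_sqrt hwv))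
      have hle : 1 / √(2 * u ^ 2 - u ^ 4) ≤ u / √(2 - u ^ 2) := by
        rw [sqrt_two_mul_sq_sub hu, div_le_div_iff₀ (by positivity) hs]
        nlinarith [mul_nonneg hs.le (show 0 ≤ u ^ 2 - 1 by nlinarith)]
      rw [abs_le]
      constructor <;>
        linarith [sqrtQuot_nonneg hh (2 * u ^ 2 - u ^ 4), sqrtQuot_nonneg hh (2 * u ^ 2)]
  · intro u hu
    exact (tendsto_sqrtQuot (level_pos hu)).sub
      (tendsto_sqrtQuot (by have := hu.1; positivity))

lemma integral_sqrt_two_mul_sq_add {h : ℝ} (h1 : -1 < h) (h0 : h < 0) :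
    ∫ u in (0 : ℝ)..√2, √(2 * u ^ 2 + h)
      = √2 * √(4 + h) / 2 + h / (2 * √2) * Real.log (2 + √(4 + h))
        - h / (4 * √2) * Real.log (-h) := by
  have hr : 0 < √2 := Real.sqrt_pos.2 (by norm_num)
  have hr2 : √2 ^ 2 = 2 := Real.sq_sqrt (by norm_num)
  have hint : ∀ a b : ℝ, IntervalIntegrable (fun u : ℝ => √(2 * u ^ 2 + h)) volume a b :=
    fun a b => Continuous.intervalIntegrable (by fun_prop) _ _
  set c := √(-h / 2) with hc
  have hc0 : 0 < c := Real.sqrt_pos.2 (by linarith)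
  have hc2 : c ^ 2 = -h / 2 := Real.sq_sqrt (by linarith)
  have hcr : c ≤ √2 := Real.sqrt_le_sqrt (by linarith)
  have hl : ∫ u in (0 : ℝ)..c, √(2 * u ^ 2 + h) = 0 := by
    rw [intervalIntegral.integral_congr_uIoo (g := fun _ => (0 : ℝ))]
    · simp
    · intro u hu
      rw [uIoo_of_le hc0.le] at hu
      exact Real.sqrt_eq_zero_of_nonpos (by nlinarith [hu.1, hu.2])
  have hF : ∫ u in c..√2, √(2 * u ^ 2 + h)
      = (√2 * √(2 * √2 ^ 2 + h) / 2 + h / (2 * √2) * Real.log (√2 * √2 + √(2 * √2 ^ 2 + h)))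
        - (c * √(2 * c ^ 2 + h) / 2 + h / (2 * √2) * Real.log (√2 * c + √(2 * c ^ 2 + h))) := by
    refine intervalIntegral.integral_eq_sub_of_hasDerivAt_of_le
      (f := fun u => u * √(2 * u ^ 2 + h) / 2
        + h / (2 * √2) * Real.log (√2 * u + √(2 * u ^ 2 + h))) hcr ?_ ?_ (hint _ _)
    · refine ContinuousOn.add (by fun_prop)
        (ContinuousOn.mul continuousOn_const (ContinuousOn.log (by fun_prop) ?_))
      intro u hu
      have : 0 < u := hc0.trans_le hu.1
      positivity
    · intro u hu
      have hu0 : 0 < u := hc0.trans hu.1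
      have hp : 0 < 2 * u ^ 2 + h := by nlinarith [hu.1]
      have hs := Real.sqrt_pos.2 hp
      have hq := Real.sq_sqrt hp.le
      have hd : HasDerivAt (fun u : ℝ => √(2 * u ^ 2 + h)) (2 * u / √(2 * u ^ 2 + h)) u := by
        refine ((((hasDerivAt_pow 2 u).const_mul 2).add_const h).sqrt hp.ne').congr_deriv ?_
        field_simp
        simp
      refine ((((hasDerivAt_id u).mul hd).div_const 2).add
        (((((hasDerivAt_id u).const_mul (√2)).add hd).log ?_).const_mul
          (h / (2 * √2)))).congr_deriv ?_
      · simp only [Pi.add_apply, id]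
        positivity
      · simp only [Pi.add_apply, id]
        generalize √(2 * u ^ 2 + h) = s at *
        generalize √2 = r at *
        have hh : h = s ^ 2 - 2 * u ^ 2 := by linarith
        rw [hh]
        field_simp
        ring_nf
        simp only [hr2]
        ring
  have hlog : Real.log (√2 * c) = Real.log (-h) / 2 := by
    rw [hc, ← Real.sqrt_mul (by norm_num), show (2 : ℝ) * (-h / 2) = -h by ring,
      Real.log_sqrt (by linarith)]
  rw [← intervalIntegral.integral_add_adjacent_intervals (hint 0 c) (hint c (√2)), hl, hF,
    show 2 * c ^ 2 + h = 0 by rw [hc2]; ring, Real.sqrt_zero, add_zero, hlog, hr2,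
    Real.mul_self_sqrt (by norm_num)]
  norm_num
  ring

lemma integral_sqrt_two_mul_sq : ∫ u in (0 : ℝ)..√2, √(2 * u ^ 2) = √2 := by
  have hr2 : √2 ^ 2 = 2 := Real.sq_sqrt (by norm_num)
  rw [intervalIntegral.integral_congr_uIoo (g := fun u => √2 * u)]
  · rw [intervalIntegral.integral_const_mul, integral_id, hr2]
    ring
  · intro u hu
    rw [uIoo_of_le (Real.sqrt_nonneg 2)] at hu
    exact sqrt_two_mul_sq hu.1.le

lemma integral_sqrtQuot_two_mul_sq {h : ℝ} (h1 : -1 < h) (h0 : h < 0) :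
    ∫ u in (0 : ℝ)..√2, sqrtQuot h (2 * u ^ 2)
      = √2 / 2 * sqrtQuot h 4 + 1 / (2 * √2) * Real.log (2 + √(4 + h))
        - Real.log (-h) / (4 * √2) := by
  have hr : 0 < √2 := Real.sqrt_pos.2 (by norm_num)
  unfold sqrtQuot
  rw [intervalIntegral.integral_const_mul, intervalIntegral.integral_sub
    (Continuous.intervalIntegrable (by fun_prop) _ _)
    (Continuous.intervalIntegrable (by fun_prop) _ _),
    integral_sqrt_two_mul_sq_add h1 h0, integral_sqrt_two_mul_sq,
    show √(4 : ℝ) = 2 by rw [show (4 : ℝ) = 2 ^ 2 by norm_num, Real.sqrt_sq (by norm_num)]]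
  have := h0.ne
  field_simp
  ring

lemma tendsto_Ibar_zero :
    Tendsto (fun h => h⁻¹ * (Ibar 0 h - 2 * √2 / 3) + Real.log (-h) / (4 * √2)) (𝓝[<] 0)
      (𝓝 ((1 + 6 * Real.log 2) / (4 * √2))) := by
  have hr : 0 < √2 := Real.sqrt_pos.2 (by norm_num)
  have hr2 : √2 ^ 2 = 2 := Real.sq_sqrt (by norm_num)
  have h4 : √(4 : ℝ) = 2 := by
    rw [show (4 : ℝ) = 2 ^ 2 by norm_num, Real.sqrt_sq (by norm_num)]
  have hl : Tendsto (fun h : ℝ => Real.log (2 + √(4 + h))) (𝓝[<] 0) (𝓝 (2 * Real.log 2)) := by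
    have hc : ContinuousAt (fun h : ℝ => Real.log (2 + √(4 + h))) 0 :=
      ContinuousAt.log (by fun_prop) (by positivity)
    have hv : Real.log (2 + √(4 + 0)) = 2 * Real.log 2 := by
      rw [add_zero, h4, show (2 : ℝ) + 2 = 2 ^ 2 by norm_num, Real.log_pow]
      norm_num
    have := hc.tendsto
    rw [hv] at this
    exact this.mono_left nhdsWithin_le_nhds
  have key := tendsto_integral_regularized.add
    (((tendsto_sqrtQuot (show (0 : ℝ) < 4 by norm_num)).const_mul (√2 / 2)).add
      (hl.const_mul (1 / (2 * √2))))
  have hval : Real.log 2 / (2 * √2)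
      + (√2 / 2 * (1 / (2 * √4)) + 1 / (2 * √2) * (2 * Real.log 2))
      = (1 + 6 * Real.log 2) / (4 * √2) := by
    rw [h4]
    field_simp
    rw [hr2]
    ring
  rw [hval] at key
  refine key.congr' ?_
  filter_upwards [eventually_neg_one_lt] with h hh
  have hI := integral_sqrtQuot_Ibar 0 hh.1 hh.2
  simp only [pow_zero, one_mul] at hI
  rw [integral_sqrt_zero_level] at hI
  rw [intervalIntegral.integral_sub, hI, integral_sqrtQuot_two_mul_sq hh.1 hh.2]
  · ring
  · exact ((continuous_sqrtQuot h).comp (by fun_prop)).intervalIntegrable _ _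
  · exact ((continuous_sqrtQuot h).comp (by fun_prop)).intervalIntegrable _ _

/-- As `h → 0⁻`,
`Ī₀(h) = 2√2/3 + h(−log(−h) + 1 + 6 log 2)/(4√2) + o(h)` and
`Ī₂(h) = 8√2/15 + h/√2 + o(h)`. -/
theorem stmt10 :
    (fun h : ℝ =>
        Ibar 0 h - 2 * Real.sqrt 2 / 3 -
          h * (-Real.log (-h) + 1 + 6 * Real.log 2) / (4 * Real.sqrt 2))
      =o[nhdsWithin 0 (Set.Iio (0 : ℝ))] (fun h : ℝ => h) ∧
    (fun h : ℝ => Ibar 2 h - 8 * Real.sqrt 2 / 15 - h / Real.sqrt 2)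
      =o[nhdsWithin 0 (Set.Iio (0 : ℝ))] (fun h : ℝ => h) := by
  have hr : 0 < √2 := Real.sqrt_pos.2 (by norm_num)
  have hr2 : √2 ^ 2 = 2 := Real.sq_sqrt (by norm_num)
  have hne : ∀ᶠ h : ℝ in 𝓝[<] 0, h ≠ 0 := by
    filter_upwards [self_mem_nhdsWithin] with h hh using ne_of_lt hh
  constructor
  · rw [isLittleO_iff_tendsto' (hne.mono fun h hh h0 => absurd h0 hh)]
    have key := tendsto_Ibar_zero.sub_const ((1 + 6 * Real.log 2) / (4 * √2))
    rw [sub_self] at key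
    refine key.congr' ?_
    filter_upwards [hne] with h hh
    field_simp
    ring
  · rw [isLittleO_iff_tendsto' (hne.mono fun h hh h0 => absurd h0 hh)]
    have key := tendsto_Ibar_two.sub_const (√2 / 2)
    rw [sub_self] at key
    refine key.congr' ?_
    filter_upwards [hne] with h hh
    have hinv : √2 / 2 = 1 / √2 := by
      field_simp
      exact hr2
    rw [hinv]
    field_simp
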